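/- Let n = (k-1)k/2 + r with 0 < r ≤ k. The number of distinct cycles of the Bulgarian solitaire operator B acting on partitions of n equals (1/k) Σ_{d | gcd(r,k)} φ(d) · C(k/d, r/d), the number of binary necklaces of length k with exactly r black beads under cyclic rotation. -/

import Mathlib

/-- A partition of `n`: a multiset of positive integers summing to `n`
(multisets model nonincreasing sequences, since order is irrelevant). -/
def IsPartition (n : ℕ) (l : Multiset ℕ) : Prop :=
  l.sum = n ∧ ∀ x ∈ l, 0 < x

/-- The Bulgarian solitaire move: remove one card from each pile, discard empty
piles, and add a new pile whose size is the number of old piles. -/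
def bulg (l : Multiset ℕ) : Multiset ℕ :=
  (Multiset.card l ::ₘ l.map (· - 1)).filter (0 < ·)

/-- The staircase partition `(k, k-1, …, 2, 1)`. -/
def staircase (k : ℕ) : Multiset ℕ := (Multiset.range k).map (· + 1)

/-- Rotation equivalence of binary colourings of a cycle of length k. -/
def NecklaceRel (k : ℕ) (f g : Fin k → Bool) : Prop :=
  ∃ c : Fin k, ∀ x : Fin k, f (x + c) = g x

/-- The number of parts of `l` exceeding `j`, i.e. the `j`-th part of the conjugate partition. -/
def conjPart (l : Multiset ℕ) (j : ℕ) : ℕ := l.countP (j < ·)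

lemma conjPart_zero {l : Multiset ℕ} (hl : ∀ x ∈ l, 0 < x) : conjPart l 0 = l.card :=
  Multiset.countP_eq_card.2 hl

lemma conjPart_map_pred (l : Multiset ℕ) (j : ℕ) :
    conjPart (l.map (· - 1)) j = conjPart l (j + 1) := by
  unfold conjPart
  rw [Multiset.countP_map, Multiset.countP_eq_card_filter]
  congr 2
  ext x
  omega

lemma conjPart_filter_pos (l : Multiset ℕ) (j : ℕ) :
    conjPart (l.filter (0 < ·)) j = conjPart l j := by
  unfold conjPart
  rw [Multiset.countP_filter]
  congr 1
  ext x
  omega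

lemma conjPart_bulg (l : Multiset ℕ) (j : ℕ) :
    conjPart (bulg l) j = conjPart l (j + 1) + if j < l.card then 1 else 0 := by
  rw [bulg, conjPart_filter_pos, ← conjPart_map_pred]
  simp [conjPart, Multiset.countP_cons]

lemma eq_of_conjPart_eq {l m : Multiset ℕ} (hl : ∀ x ∈ l, 0 < x) (hm : ∀ x ∈ m, 0 < x)
    (h : ∀ j, conjPart l j = conjPart m j) : l = m := by
  have key : ∀ (l : Multiset ℕ) (x : ℕ), conjPart l x = l.count (x + 1) + conjPart l (x + 1) := by
    intro l x
    induction l using Multiset.induction_on with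
    | empty => simp [conjPart]
    | cons a l ih =>
      simp only [conjPart, Multiset.countP_cons, Multiset.count_cons] at ih ⊢
      split_ifs <;> omega
  ext x
  cases x with
  | zero =>
    rw [Multiset.count_eq_zero_of_notMem fun h => (hl 0 h).false,
      Multiset.count_eq_zero_of_notMem fun h => (hm 0 h).false]
  | succ x =>
    have h1 := key l x
    have h2 := key m x
    have h3 := h x
    have h4 := h (x + 1)
    omega

lemma sum_conjPart {N : ℕ} {l : Multiset ℕ} (hl : ∀ x ∈ l, x ≤ N) :
    ∑ j ∈ Finset.range N, conjPart l j = l.sum := by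
  induction l using Multiset.induction_on with
  | empty => simp [conjPart]
  | cons a l ih =>
    simp only [Multiset.mem_cons, forall_eq_or_imp] at hl
    simp only [conjPart, Multiset.countP_cons, Finset.sum_add_distrib] at ih ⊢
    rw [ih hl.2, Finset.sum_boole, Multiset.sum_cons, add_comm]
    congr 1
    have : (Finset.range N).filter (· < a) = Finset.range a := by
      ext; simp; omega
    simp [this]

lemma conjPart_eq_zero {l : Multiset ℕ} {j : ℕ} (hl : ∀ x ∈ l, x ≤ j) : conjPart l j = 0 := by
  rw [conjPart, Multiset.countP_eq_zero]
  intro x hx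
  have := hl x hx
  omega

lemma bulg_pos (l : Multiset ℕ) : ∀ x ∈ bulg l, 0 < x := fun _ hx => (Multiset.mem_filter.1 hx).2

lemma sum_filter_pos (l : Multiset ℕ) : (l.filter (0 < ·)).sum = l.sum := by
  induction l using Multiset.induction_on with
  | empty => simp
  | cons a l ih =>
    rcases Nat.eq_zero_or_pos a with rfl | h
    · simp [ih]
    · simp [h, ih]

lemma card_add_sum_map_pred {l : Multiset ℕ} (hl : ∀ x ∈ l, 0 < x) :
    l.card + (l.map (· - 1)).sum = l.sum := by
  induction l using Multiset.induction_on with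
  | empty => simp
  | cons a l ih =>
    simp only [Multiset.mem_cons, forall_eq_or_imp] at hl
    have := ih hl.2
    simp only [Multiset.card_cons, Multiset.map_cons, Multiset.sum_cons]
    omega

lemma IsPartition.bulg {n : ℕ} {l : Multiset ℕ} (hl : IsPartition n l) :
    IsPartition n (bulg l) := by
  refine ⟨?_, bulg_pos l⟩
  rw [_root_.bulg, sum_filter_pos, Multiset.sum_cons, card_add_sum_map_pred hl.2, hl.1]

lemma IsPartition.iterate_bulg {n : ℕ} {l : Multiset ℕ} (hl : IsPartition n l) (t : ℕ) :
    IsPartition n (_root_.bulg^[t] l) := by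
  induction t with
  | zero => exact hl
  | succ t ih => rw [Function.iterate_succ_apply']; exact ih.bulg

lemma IsPartition.le {n : ℕ} {l : Multiset ℕ} (hl : IsPartition n l) : ∀ x ∈ l, x ≤ n :=
  fun _ hx => hl.1 ▸ Multiset.le_sum_of_mem hx

/-- The sum over all cells of the Young diagram of `l` of the distance `i + j` to the corner cell,
for `l` with all parts at most `N`. -/
def energy (N : ℕ) (l : Multiset ℕ) : ℕ :=
  (l.map (·.choose 2)).sum + ∑ j ∈ Finset.range (N + 1), (conjPart l j).choose 2

lemma energy_bulg {n : ℕ} {l : Multiset ℕ} (hl : IsPartition n l) :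
    energy n (bulg l) +
      (∑ j ∈ Finset.range (n + 1), if j < l.card then 0 else conjPart l (j + 1)) =
      energy n l := by
  have h1 : ((bulg l).map (·.choose 2)).sum =
      l.card.choose 2 + (l.map fun x => (x - 1).choose 2).sum := by
    have : ∀ m : Multiset ℕ, ((m.filter (0 < ·)).map (·.choose 2)).sum =
        (m.map (·.choose 2)).sum := by
      intro m
      induction m using Multiset.induction_on with
      | empty => simp
      | cons a m ih =>
        rcases Nat.eq_zero_or_pos a with rfl | h
        · simp [ih]
        · simp [h, ih]
    rw [bulg, this]
    simp
  have h2 : (l.map (·.choose 2)).sum =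
      (l.map fun x => (x - 1).choose 2).sum + (l.map (· - 1)).sum := by
    rw [← Multiset.sum_map_add]
    refine congrArg _ (Multiset.map_congr rfl fun x hx => ?_)
    obtain ⟨y, rfl⟩ := Nat.exists_eq_succ_of_ne_zero (hl.2 x hx).ne'
    simp [Nat.choose_succ_succ' y 1, add_comm]
  have h3 : ∑ j ∈ Finset.range (n + 1), conjPart l (j + 1) = (l.map (· - 1)).sum := by
    rw [← sum_conjPart (N := n + 1) (l := l.map (· - 1))]
    · simp_rw [conjPart_map_pred]
    · intro x hx
      obtain ⟨y, hy, rfl⟩ := Multiset.mem_map.1 hx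
      have := hl.le y hy
      omega
  have h4 : ∑ j ∈ Finset.range (n + 1), (conjPart l j).choose 2 =
      l.card.choose 2 + ∑ j ∈ Finset.range (n + 1), (conjPart l (j + 1)).choose 2 := by
    rw [Finset.sum_range_succ', Finset.sum_range_succ _ n, conjPart_zero hl.2,
      conjPart_eq_zero fun x hx => (hl.le x hx).trans n.le_succ]
    simp [add_comm]
  have h5 : ∑ j ∈ Finset.range (n + 1), (conjPart (bulg l) j).choose 2 +
      (∑ j ∈ Finset.range (n + 1), if j < l.card then 0 else conjPart l (j + 1)) =
      ∑ j ∈ Finset.range (n + 1), (conjPart l (j + 1)).choose 2 +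
        ∑ j ∈ Finset.range (n + 1), conjPart l (j + 1) := by
    simp_rw [← Finset.sum_add_distrib]
    refine Finset.sum_congr rfl fun j _ => ?_
    rw [conjPart_bulg]
    split_ifs
    · rw [Nat.choose_succ_succ' _ 1, Nat.choose_one_right, add_zero, add_comm]
    · simp
  unfold energy
  omega

lemma conjPart_eq_zero_of_recurrent {n p : ℕ} {l : Multiset ℕ} (hl : IsPartition n l)
    (hp : 1 ≤ p) (h : bulg^[p] l = l) {j : ℕ} (hj : l.card < j) : conjPart l j = 0 := by
  have anti : Antitone fun i => energy n (bulg^[i] l) := by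
    refine antitone_nat_of_succ_le fun i => ?_
    rw [Function.iterate_succ_apply', ← energy_bulg (hl.iterate_bulg i)]
    exact Nat.le_add_right _ _
  have h1 : energy n (bulg^[p] l) ≤ energy n (bulg^[1] l) := anti hp
  have h2 := energy_bulg hl
  rw [h, Function.iterate_one] at h1
  have h3 : (∑ j ∈ Finset.range (n + 1), if j < l.card then 0 else conjPart l (j + 1)) = 0 := by
    omega
  rw [Finset.sum_eq_zero_iff] at h3
  by_cases hjn : j ≤ n
  · have := h3 (j - 1) (Finset.mem_range.2 (by omega))
    rwa [if_neg (by omega), Nat.sub_add_cancel (by omega)] at this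
  · exact conjPart_eq_zero fun x hx => (hl.le x hx).trans (by omega)

lemma iterate_bulg_recurrent {p : ℕ} {l : Multiset ℕ} (h : bulg^[p] l = l) (i : ℕ) :
    bulg^[p] (bulg^[i] l) = bulg^[i] l := by
  rw [← Function.iterate_add_apply, add_comm, Function.iterate_add_apply, h]

lemma conjPart_iterate_of_recurrent {n p : ℕ} {l : Multiset ℕ} (hl : IsPartition n l)
    (hp : 1 ≤ p) (h : bulg^[p] l = l) (i j : ℕ) :
    conjPart (bulg^[i] l) j = (bulg^[i + j] l).card - j := by
  induction j generalizing i with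
  | zero => exact conjPart_zero (hl.iterate_bulg i).2
  | succ j ih =>
    have h1 := ih (i + 1)
    rw [Function.iterate_succ_apply', conjPart_bulg, add_right_comm] at h1
    rw [← add_assoc]
    split_ifs at h1 with h2
    · omega
    · have := conjPart_eq_zero_of_recurrent (hl.iterate_bulg i) hp (iterate_bulg_recurrent h i)
        (j := j + 1) (by omega)
      omega

lemma add_mul_mem_iff_of_periodic {A : ℕ → Prop} {p : ℕ} (hA : ∀ i, A (i + p) ↔ A i) (t i : ℕ) :
    A (i + p * t) ↔ A i := by
  induction t with
  | zero => rfl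
  | succ t ih => rw [mul_add_one, ← add_assoc, hA, ih]

lemma mem_add_mul_of_closed {A : ℕ → Prop} {v : ℕ} (hA : ∀ i, A i → A (i + v)) (t i : ℕ)
    (hi : A i) : A (i + v * t) := by
  induction t with
  | zero => exact hi
  | succ t ih => rw [mul_add_one, ← add_assoc]; exact hA _ ih

lemma exists_two_values {s : ℕ → ℕ} {p : ℕ} (hp : 1 ≤ p) (hper : ∀ i, s (i + p) = s i)
    (hshift : ∀ i v, v ≤ s i → v ≤ s (i + v)) (hdrop : ∀ i, s i ≤ s (i + 1) + 1) :
    ∃ M, (∀ i, s i ≤ M ∧ M ≤ s i + 1) ∧ (∃ i, s i = M) ∧ ∀ i, s (i + M) = s i := by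
  obtain ⟨i₀, -, hmax⟩ := Finset.exists_max_image (Finset.range p) s
    ⟨0, Finset.mem_range.2 hp⟩
  have hmax' : ∀ i, s i ≤ s i₀ := fun i => by
    rw [← Function.Periodic.map_mod_nat (f := s) hper i]
    exact hmax _ (Finset.mem_range.2 (Nat.mod_lt _ hp))
  have hlow : ∀ i, s i₀ ≤ s i + 1 := by
    intro i
    rcases le_or_gt (s i₀) 1 with h | h
    · omega
    obtain ⟨v, hv⟩ : ∃ v, s i₀ = v + 1 := ⟨s i₀ - 1, by omega⟩
    have hall : ∀ N, v * v ≤ N → v ≤ s (i₀ + 1 + N) := by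
      intro N hN
      have h1 : v + 1 ≤ s (i₀ + (v + 1) * (N % v)) :=
        mem_add_mul_of_closed (A := fun i => v + 1 ≤ s i) (fun i => hshift i _) _ _ hv.ge
      have h2 := hdrop (i₀ + (v + 1) * (N % v))
      have h3 : v ≤ s (i₀ + (v + 1) * (N % v) + 1 + v * (N / v - N % v)) :=
        mem_add_mul_of_closed (A := fun i => v ≤ s i) (fun i => hshift i _) _ _ (by omega)
      have h4 : N % v ≤ N / v :=
        (Nat.mod_lt _ (by omega)).le.trans ((Nat.le_div_iff_mul_le (by omega)).2 hN)
      convert h3 using 2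
      obtain ⟨u, hu⟩ := Nat.exists_eq_add_of_le h4
      have h5 := Nat.div_add_mod N v
      rw [hu] at h5 ⊢
      rw [Nat.add_sub_cancel_left]
      nlinarith
    have h1 : v ≤ s (i + p * (i₀ + 1 + v * v)) := by
      have h2 : i₀ + 1 + v * v ≤ i + p * (i₀ + 1 + v * v) :=
        (Nat.le_mul_of_pos_left _ hp).trans (Nat.le_add_left _ _)
      have := hall (i + p * (i₀ + 1 + v * v) - (i₀ + 1)) (by omega)
      rwa [Nat.add_sub_cancel' (by omega)] at this
    rw [add_mul_mem_iff_of_periodic (A := fun i => v ≤ s i) (by simp [hper])] at h1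
    omega
  refine ⟨s i₀, fun i => ⟨hmax' i, hlow i⟩, ⟨i₀, rfl⟩, fun i => ?_⟩
  have h1 := hshift i (s i₀)
  have h2 : s i₀ ≤ s (i + s i₀) → s i₀ ≤ s i := by
    intro h
    have := mem_add_mul_of_closed (A := fun i => s i₀ ≤ s i) (fun i => hshift i _) (p - 1) _ h
    have h3 : i + s i₀ + s i₀ * (p - 1) = i + p * s i₀ := by
      obtain ⟨q, rfl⟩ := Nat.exists_eq_add_of_le' hp
      rw [Nat.add_sub_cancel]; ring
    rw [h3] at this
    exact (add_mul_mem_iff_of_periodic (A := fun i => s i₀ ≤ s i) (by simp [hper]) _ _).1 this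
  have := hmax' i
  have := hlow i
  have := hmax' (i + s i₀)
  have := hlow (i + s i₀)
  omega

/-- The partition with parts `j + b j` for `j < k`, where the part `0` is discarded. -/
def ofColouring (k : ℕ) (b : ℕ → Bool) : Multiset ℕ :=
  ((Multiset.range k).map fun j => j + (b j).toNat).filter (0 < ·)

lemma ofColouring_pos (k : ℕ) (b : ℕ → Bool) : ∀ x ∈ ofColouring k b, 0 < x :=
  fun _ hx => (Multiset.mem_filter.1 hx).2

lemma conjPart_ofColouring (k : ℕ) (b : ℕ → Bool) (w : ℕ) :
    conjPart (ofColouring k b) w = k + (b w).toNat - (w + 1) := by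
  rw [ofColouring, conjPart_filter_pos]
  induction k with
  | zero =>
    have := (b w).toNat_le
    simp only [Multiset.range_zero, Multiset.map_zero, conjPart, Multiset.countP_zero]
    omega
  | succ k ih =>
    simp only [conjPart, Multiset.range_succ, Multiset.map_cons, Multiset.countP_cons] at ih ⊢
    rw [ih]
    have := (b w).toNat_le
    have := (b k).toNat_le
    rcases lt_trichotomy w k with h | rfl | h <;> split_ifs <;> omega

lemma sum_ofColouring (k : ℕ) (b : ℕ → Bool) :
    (ofColouring k b).sum = k * (k - 1) / 2 + ∑ j ∈ Finset.range k, (b j).toNat := by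
  rw [ofColouring, sum_filter_pos, ← Finset.sum_range_id, ← Finset.sum_add_distrib]
  rfl

lemma bulg_ofColouring {k : ℕ} {b : ℕ → Bool} (hb : b k = b 0) :
    bulg (ofColouring k b) = ofColouring k fun j => b (j + 1) := by
  refine eq_of_conjPart_eq (bulg_pos _) (ofColouring_pos _ _) fun j => ?_
  rw [conjPart_bulg, ← conjPart_zero (ofColouring_pos k b)]
  simp only [conjPart_ofColouring]
  have := (b (j + 1)).toNat_le
  have := (b 0).toNat_le
  rcases eq_or_ne (j + 1) k with rfl | h
  · rw [hb]
    split_ifs <;> omega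
  · split_ifs <;> omega

lemma iterate_bulg_ofColouring {k : ℕ} {b : ℕ → Bool} (hb : ∀ i, b (i + k) = b i) (t : ℕ) :
    bulg^[t] (ofColouring k b) = ofColouring k fun j => b (j + t) := by
  induction t with
  | zero => rfl
  | succ t ih =>
    rw [Function.iterate_succ_apply', ih, bulg_ofColouring]
    · simp only [add_assoc, add_comm 1]
    · rw [add_comm k, hb, zero_add]

lemma eq_of_ofColouring_eq {k : ℕ} {b b' : ℕ → Bool} (h : ofColouring k b = ofColouring k b')
    {w : ℕ} (hw : w < k) : b w = b' w := by
  have := congrArg (conjPart · w) h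
  simp only [conjPart_ofColouring] at this
  cases hb : b w <;> cases hb' : b' w <;>
    simp only [hb, hb', Bool.toNat_true, Bool.toNat_false] at this <;>
    first | rfl | omega

lemma exists_ofColouring_of_recurrent {n p : ℕ} {l : Multiset ℕ} (hl : IsPartition n l)
    (hp : 1 ≤ p) (h : bulg^[p] l = l) :
    ∃ M b, (∀ i, b (i + M) = b i) ∧ (∃ i, b i = true) ∧ l = ofColouring M b := by
  obtain ⟨M, hM, ⟨i, hi⟩, hper⟩ := exists_two_values (s := fun i => (bulg^[i] l).card) hp
    (fun i => by rw [Function.iterate_add_apply, h])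
    (fun i v hv => by
      rcases Nat.eq_zero_or_pos v with rfl | hv0
      · exact Nat.zero_le _
      have h1 := conjPart_iterate_of_recurrent hl hp h (i + 1) (v - 1)
      rw [Function.iterate_succ_apply', conjPart_bulg, if_pos (by omega),
        show i + 1 + (v - 1) = i + v by omega] at h1
      omega)
    (fun i => by
      by_contra! hlt
      have h1 := conjPart_eq_zero_of_recurrent (hl.iterate_bulg (i + 1)) hp
        (iterate_bulg_recurrent h _) (j := (bulg^[i] l).card - 1) (by omega)
      rw [Function.iterate_succ_apply', conjPart_bulg, if_pos (by omega)] at h1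
      omega)
  refine ⟨M, fun i => decide ((bulg^[i] l).card = M), fun i => by simp only [hper],
    ⟨i, by simpa using hi⟩, eq_of_conjPart_eq hl.2 (ofColouring_pos _ _) fun j => ?_⟩
  have h1 := conjPart_iterate_of_recurrent hl hp h 0 j
  rw [Function.iterate_zero_apply, zero_add] at h1
  rw [h1, conjPart_ofColouring]
  have := hM j
  by_cases hj : (bulg^[j] l).card = M
  · simp only [hj, decide_true, Bool.toNat_true]
    omega
  · simp only [hj, decide_false, Bool.toNat_false]
    omega

lemma triangular_add_unique {k r m s : ℕ} (hr : 0 < r) (hrk : r ≤ k) (hs : 0 < s) (hsm : s ≤ m)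
    (h : k * (k - 1) / 2 + r = m * (m - 1) / 2 + s) : k = m ∧ r = s := by
  have key : ∀ a b : ℕ, a < b → a * (a - 1) / 2 + a ≤ b * (b - 1) / 2 := fun a b hab => by
    simp_rw [← Finset.sum_range_id]
    rw [← Finset.sum_range_succ]
    exact Finset.sum_le_sum_of_subset (Finset.range_subset_range.2 hab)
  rcases lt_trichotomy k m with hkm | rfl | hkm
  · have := key _ _ hkm
    omega
  · omega
  · have := key _ _ hkm
    omega

/-- The `k`-periodic extension to `ℕ` of a colouring of `Fin k`. -/
def periodicExt {k : ℕ} [NeZero k] (f : Fin k → Bool) (j : ℕ) : Bool := f (Fin.ofNat k j)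

lemma periodicExt_add {k : ℕ} [NeZero k] (f : Fin k → Bool) (i : ℕ) :
    periodicExt f (i + k) = periodicExt f i := by
  simp [periodicExt, Fin.ofNat]

lemma periodicExt_of_periodic {k : ℕ} [NeZero k] {b : ℕ → Bool} (hb : ∀ i, b (i + k) = b i) :
    periodicExt (fun i : Fin k => b i) = b :=
  funext fun j => Function.Periodic.map_mod_nat (f := b) hb j

lemma sum_periodicExt {k : ℕ} [NeZero k] (f : Fin k → Bool) :
    ∑ j ∈ Finset.range k, (periodicExt f j).toNat =
      (Finset.univ.filter fun x => f x = true).card := by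
  rw [Finset.sum_range, Finset.card_filter]
  refine Finset.sum_congr rfl fun i _ => ?_
  simp only [periodicExt, Fin.ofNat_val_eq_self]
  cases f i <;> rfl

/-- Recurrent partitions of `n` correspond to colourings of a cycle of length `k` with `r` black
beads. -/
noncomputable def colouringEquivRecurrent {k r n : ℕ} [NeZero k] (hr : 0 < r) (hrk : r ≤ k)
    (hn : n = k * (k - 1) / 2 + r) :
    {b : Fin k → Bool // (Finset.univ.filter fun x => b x = true).card = r} ≃
      {l : Multiset ℕ // IsPartition n l ∧ ∃ p : ℕ, 1 ≤ p ∧ bulg^[p] l = l} :=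
  Equiv.ofBijective
    (fun f => ⟨ofColouring k (periodicExt f.1),
      ⟨by rw [sum_ofColouring, sum_periodicExt, f.2, hn], ofColouring_pos _ _⟩,
      k, NeZero.one_le, by
        rw [iterate_bulg_ofColouring (periodicExt_add f.1)]
        simp only [periodicExt_add]⟩)
    (by
      refine ⟨fun f g hfg => Subtype.ext (funext fun i => ?_), fun ⟨l, hl, p, hp, h⟩ => ?_⟩
      · simpa [periodicExt] using eq_of_ofColouring_eq (congrArg Subtype.val hfg) i.2
      · obtain ⟨M, b, hb, ⟨i, hi⟩, rfl⟩ := exists_ofColouring_of_recurrent hl hp h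
        have hsum := hl.1
        rw [sum_ofColouring] at hsum
        have hM : 0 < M := by
          rcases Nat.eq_zero_or_pos M with rfl | hM
          · simp at hsum
            omega
          · exact hM
        have hpos : 0 < ∑ j ∈ Finset.range M, (b j).toNat := by
          refine Finset.sum_pos' (fun _ _ => Nat.zero_le _)
            ⟨i % M, Finset.mem_range.2 (Nat.mod_lt _ hM), ?_⟩
          rw [Function.Periodic.map_mod_nat (f := b) hb, hi]
          exact Nat.one_pos
        have hle : ∑ j ∈ Finset.range M, (b j).toNat ≤ M := by
          simpa using Finset.sum_le_card_nsmul (Finset.range M) _ 1 fun j _ => (b j).toNat_le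
        obtain ⟨rfl, hrs⟩ := triangular_add_unique hr hrk hpos hle (by omega)
        refine ⟨⟨fun i => b i, ?_⟩, Subtype.ext ?_⟩
        · rw [← sum_periodicExt, periodicExt_of_periodic hb, hrs]
        · simp only [periodicExt_of_periodic hb])

lemma exists_iterate_bulg_iff_necklaceRel {k : ℕ} [NeZero k] (f g : Fin k → Bool) :
    (∃ t, bulg^[t] (ofColouring k (periodicExt f)) = ofColouring k (periodicExt g)) ↔
      NecklaceRel k f g := by
  simp only [iterate_bulg_ofColouring (periodicExt_add f)]
  have hadd : ∀ (x : Fin k) (t : ℕ), periodicExt f (x + t) = f (x + Fin.ofNat k t) := by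
    intro x t
    refine congrArg f (Fin.ext ?_)
    simp [Fin.ofNat, Fin.val_add]
  constructor
  · rintro ⟨t, ht⟩
    refine ⟨Fin.ofNat k t, fun x => ?_⟩
    have := eq_of_ofColouring_eq ht x.2
    rwa [hadd, periodicExt, Fin.ofNat_val_eq_self] at this
  · rintro ⟨c, hc⟩
    refine ⟨c, congrArg _ ?_⟩
    rw [← periodicExt_of_periodic (k := k) (b := fun j => periodicExt f (j + c))]
    · refine congrArg _ (funext fun x => ?_)
      rw [hadd, Fin.ofNat_val_eq_self, hc]
    · intro i
      rw [add_right_comm, periodicExt_add]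

/-- Colourings of `G` with exactly `r` black elements. -/
abbrev Colouring (G : Type*) [Fintype G] (r : ℕ) : Type _ :=
  {b : G → Bool // (Finset.univ.filter fun x => b x = true).card = r}

lemma card_colouring (X : Type*) [Fintype X] (r : ℕ) :
    Nat.card (Colouring X r) = (Fintype.card X).choose r := by
  classical
  rw [← Fintype.card_finset_len, ← Nat.card_eq_fintype_card]
  refine Nat.card_congr
    { toFun := fun f => ⟨_, f.2⟩
      invFun := fun s => ⟨fun x => decide (x ∈ s.1), by simpa using s.2⟩
      left_inv := fun f => Subtype.ext (by simp)
      right_inv := fun s => Subtype.ext (by simp) }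

section Burnside

variable {G : Type*} [AddCommGroup G] [Fintype G] {r : ℕ}

/-- The translation action on colourings. -/
instance : AddAction G (Colouring G r) where
  vadd c f := ⟨fun x => f.1 (x + c),
    (Finset.card_equiv (Equiv.addRight c) (by simp)).trans f.2⟩
  zero_vadd f := Subtype.ext (funext fun x => congrArg f.1 (add_zero x))
  add_vadd c d f := Subtype.ext (funext fun x => congrArg f.1 (add_assoc x c d).symm)

lemma vadd_colouring_eq_iff {c : G} {f g : Colouring G r} :
    c +ᵥ f = g ↔ ∀ x, f.1 (x + c) = g.1 x := by
  rw [Subtype.ext_iff, funext_iff]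
  rfl

lemma card_filter_comp_mk (H : AddSubgroup G) [Fintype (G ⧸ H)] (g : G ⧸ H → Bool) :
    (Finset.univ.filter fun x : G => g x = true).card =
      Nat.card H * (Finset.univ.filter fun x => g x = true).card := by
  have := Nat.card_congr (QuotientAddGroup.preimageMkEquivAddSubgroupProdSet H {x | g x = true})
  rw [Nat.card_prod] at this
  rw [← Fintype.card_subtype, ← Fintype.card_subtype, ← Nat.card_eq_fintype_card,
    ← Nat.card_eq_fintype_card]
  exact this

lemma card_fixedBy_colouring (c : G) :
    Nat.card (AddAction.fixedBy (Colouring G r) c) =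
      if addOrderOf c ∣ r then (Fintype.card G / addOrderOf c).choose (r / addOrderOf c)
      else 0 := by
  classical
  let H := AddSubgroup.zmultiples c
  have hH : Nat.card H = addOrderOf c := Nat.card_zmultiples c
  have hpos : 0 < addOrderOf c := addOrderOf_pos c
  have hmem : ∀ f : Colouring G r,
      f ∈ AddAction.fixedBy (Colouring G r) c ↔ Function.Periodic f.1 c :=
    fun f => vadd_colouring_eq_iff
  have hQ : Fintype.card (G ⧸ H) = Fintype.card G / addOrderOf c := by
    have := H.card_eq_card_quotient_mul_card_addSubgroup
    rw [hH, Nat.card_eq_fintype_card, Nat.card_eq_fintype_card] at this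
    rw [this, Nat.mul_div_cancel _ hpos]
  split_ifs with hr
  · obtain ⟨m, rfl⟩ := hr
    rw [Nat.mul_div_cancel_left _ hpos, ← hQ, ← card_colouring]
    symm
    refine Nat.card_congr (Equiv.ofBijective
      (fun g => ⟨⟨fun x => g.1 x, by rw [card_filter_comp_mk, g.2, hH]⟩, (hmem _).2 fun x => ?_⟩)
      ⟨fun g g' h => ?_, fun f => ?_⟩)
    · refine congrArg g.1 (QuotientAddGroup.eq.2 ?_)
      simp [H]
    · refine Subtype.ext (funext fun q => ?_)
      induction q using QuotientAddGroup.induction_on with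
      | H x => exact congrFun (congrArg (fun f => f.1.1) h) x
    · have hf := (hmem _).1 f.2
      refine ⟨⟨hf.lift, ?_⟩, rfl⟩
      have := card_filter_comp_mk H hf.lift
      rw [hH] at this
      exact Nat.eq_of_mul_eq_mul_left hpos (this.symm.trans f.1.2)
  · rw [Nat.card_eq_zero]
    refine Or.inl ⟨fun f => hr ?_⟩
    have hf := (hmem _).1 f.2
    have := card_filter_comp_mk H hf.lift
    rw [hH] at this
    exact ⟨_, f.1.2.symm.trans this⟩

lemma card_orbits_colouring_mul_card [IsAddCyclic G] :
    Nat.card (Quotient (AddAction.orbitRel G (Colouring G r))) * Fintype.card G =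
      ∑ d ∈ (r.gcd (Fintype.card G)).divisors,
        d.totient * (Fintype.card G / d).choose (r / d) := by
  classical
  have : Fintype (Quotient (AddAction.orbitRel G (Colouring G r))) := Fintype.ofFinite _
  rw [Nat.card_eq_fintype_card,
    ← AddAction.sum_card_fixedBy_eq_card_orbits_mul_card_addGroup G (Colouring G r)]
  simp_rw [← Nat.card_eq_fintype_card (α := AddAction.fixedBy _ _), card_fixedBy_colouring]
  have hmaps : ∀ c ∈ (Finset.univ : Finset G), addOrderOf c ∈ (Fintype.card G).divisors :=
    fun c _ => Nat.mem_divisors.2 ⟨addOrderOf_dvd_card, Fintype.card_ne_zero⟩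
  have hdiv : (r.gcd (Fintype.card G)).divisors = (Fintype.card G).divisors.filter (· ∣ r) := by
    ext d
    simp [Nat.dvd_gcd_iff, and_comm]
  rw [← Finset.sum_fiberwise_of_maps_to hmaps, hdiv, Finset.sum_filter]
  refine Finset.sum_congr rfl fun d hd => ?_
  rw [Finset.sum_congr rfl fun c hc => by rw [(Finset.mem_filter.1 hc).2], Finset.sum_const,
    IsAddCyclic.card_addOrderOf_eq_totient (Nat.dvd_of_mem_divisors hd), smul_eq_mul, mul_ite,
    mul_zero]

end Burnside

lemma card_necklaces_mul (k r : ℕ) [NeZero k] :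
    Nat.card (Quot fun f g : Colouring (Fin k) r => NecklaceRel k f.1 g.1) * k =
      ∑ d ∈ (r.gcd k).divisors, d.totient * (k / d).choose (r / d) := by
  have hcyc : IsAddCyclic (Fin k) := by
    obtain ⟨m, rfl⟩ := Nat.exists_eq_succ_of_ne_zero (NeZero.ne k)
    exact inferInstanceAs (IsAddCyclic (ZMod (m + 1)))
  have h := card_orbits_colouring_mul_card (G := Fin k) (r := r)
  rw [Fintype.card_fin] at h
  rw [← h]
  congr 1
  refine Nat.card_congr (Quot.congr (Equiv.refl _) fun f g => ?_)
  rw [Equiv.refl_apply, Equiv.refl_apply, ← Quotient.eq', eq_comm, Quotient.eq']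
  exact exists_congr fun c => vadd_colouring_eq_iff.symm

/-- For n = (k-1)k/2 + r with 0 < r ≤ k, the number of cycles of the Bulgarian
solitaire on partitions of n equals (1/k) Σ_{d ∣ gcd(r,k)} φ(d)·C(k/d, r/d),
which is the number of binary necklaces of length k with r black beads. -/
theorem number_of_cycles (k r n : ℕ) (hr : 0 < r) (hrk : r ≤ k)
    (hn : n = (k - 1) * k / 2 + r) :
    Nat.card (Quot (fun l m : {l : Multiset ℕ //
        IsPartition n l ∧ ∃ p : ℕ, 1 ≤ p ∧ bulg^[p] l = l} =>
      ∃ t : ℕ, bulg^[t] l.1 = m.1)) =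
      (∑ d ∈ (Nat.gcd r k).divisors, Nat.totient d * Nat.choose (k / d) (r / d)) / k ∧
    Nat.card (Quot (fun l m : {l : Multiset ℕ //
        IsPartition n l ∧ ∃ p : ℕ, 1 ≤ p ∧ bulg^[p] l = l} =>
      ∃ t : ℕ, bulg^[t] l.1 = m.1)) =
      Nat.card (Quot (fun f g : {b : Fin k → Bool //
          (Finset.univ.filter fun x => b x = true).card = r} =>
        NecklaceRel k f.1 g.1)) := by
  have : NeZero k := ⟨by omega⟩
  rw [mul_comm] at hn
  have h : Nat.card (Quot (fun l m : {l : Multiset ℕ //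
        IsPartition n l ∧ ∃ p : ℕ, 1 ≤ p ∧ bulg^[p] l = l} =>
      ∃ t : ℕ, bulg^[t] l.1 = m.1)) =
      Nat.card (Quot fun f g : Colouring (Fin k) r => NecklaceRel k f.1 g.1) :=
    (Nat.card_congr (Quot.congr (colouringEquivRecurrent hr hrk hn) fun f g =>
      (exists_iterate_bulg_iff_necklaceRel f.1 g.1).symm)).symm
  refine ⟨?_, h⟩
  rw [h, ← card_necklaces_mul, Nat.mul_div_cancel _ (NeZero.pos k)]
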